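/- arXiv:1910.04676 — 4 statements merged into one kernel-verified Lean document; each statement's English description precedes it below -/
import Mathlib

section
/- Let (A, φ) be a classical solution of the chevron system on [0,T] with 0 ≤ c₁ < 1. Set δ₀ = 2(1−c₁)/(2+c₂) and D₀ = min(D₁,D₂). Then for every t ∈ [0,T]: (1/2)·d/dt[τ‖A(t,·)‖² + δ₀‖φ(t,·)‖²] + ‖A(t,·)‖² + δ₀·h·‖φ(t,·)‖² + δ₀‖∇A(t,·)‖² + δ₀·D₀·‖∇φ(t,·)‖² ≤ |Ω|. -/
open MeasureTheory Set

noncomputable section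

/-- Partial derivative of `f : ℝ × ℝ → E` in the first (x) variable. -/
def pdx {E : Type*} [NormedAddCommGroup E] [NormedSpace ℝ E]
    (f : ℝ × ℝ → E) (p : ℝ × ℝ) : E :=
  fderiv ℝ f p (1, 0)

/-- Partial derivative of `f : ℝ × ℝ → E` in the second (y) variable. -/
def pdy {E : Type*} [NormedAddCommGroup E] [NormedSpace ℝ E]
    (f : ℝ × ℝ → E) (p : ℝ × ℝ) : E :=
  fderiv ℝ f p (0, 1)

/-- Laplacian of `f : ℝ × ℝ → E`. -/
def lap {E : Type*} [NormedAddCommGroup E] [NormedSpace ℝ E]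
    (f : ℝ × ℝ → E) (p : ℝ × ℝ) : E :=
  pdx (pdx f) p + pdy (pdy f) p

/-- Squared `L²(Ω)` norm of `f`. -/
def l2sq {E : Type*} [NormedAddCommGroup E] [NormedSpace ℝ E]
    (Ω : Set (ℝ × ℝ)) (f : ℝ × ℝ → E) : ℝ :=
  ∫ p in Ω, ‖f p‖ ^ 2

/-- Squared `L²(Ω)` norm of the gradient of `f`, i.e. `‖∂ₓ f‖² + ‖∂_y f‖²`. -/
def gradl2sq {E : Type*} [NormedAddCommGroup E] [NormedSpace ℝ E]
    (Ω : Set (ℝ × ℝ)) (f : ℝ × ℝ → E) : ℝ :=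
  ∫ p in Ω, (‖pdx f p‖ ^ 2 + ‖pdy f p‖ ^ 2)

/-- A classical solution of the chevron pattern system on `[0,T]`:
`A, φ` are `C¹` in time (jointly continuously in `(t,x,y)`), `C²` in the space
variables, compactly supported in `Ω` uniformly in time, and satisfy
`τ ∂ₜA = A + ΔA − φ²A − |A|²A − 2i c₁ φ ∂_yA + iβ A ∂_yφ` and
`∂ₜφ = D₁∂ₓ²φ + D₂∂_y²φ − hφ + φ|A|² − c₂ Im(A* ∂_yA)` pointwise on `Ω`. -/
structure IsChevronSolution (Ω : Set (ℝ × ℝ)) (T τ D₁ D₂ h c₁ c₂ β : ℝ)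
    (A : ℝ → ℝ × ℝ → ℂ) (φ : ℝ → ℝ × ℝ → ℝ) : Prop where
  smooth_A : ContDiff ℝ 1 (fun q : ℝ × (ℝ × ℝ) => A q.1 q.2)
  smooth_φ : ContDiff ℝ 1 (fun q : ℝ × (ℝ × ℝ) => φ q.1 q.2)
  space_A : ∀ t ∈ Icc (0 : ℝ) T, ContDiff ℝ 2 (A t)
  space_φ : ∀ t ∈ Icc (0 : ℝ) T, ContDiff ℝ 2 (φ t)
  support : ∃ K : Set (ℝ × ℝ), IsCompact K ∧ K ⊆ Ω ∧
    ∀ t, Function.support (A t) ⊆ K ∧ Function.support (φ t) ⊆ K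
  eq_A : ∀ t ∈ Icc (0 : ℝ) T, ∀ p ∈ Ω,
    (τ : ℂ) * deriv (fun s => A s p) t =
      A t p + lap (A t) p - (φ t p : ℂ) ^ 2 * A t p - (‖A t p‖ ^ 2 : ℝ) * A t p
        - 2 * Complex.I * (c₁ : ℂ) * (φ t p : ℂ) * pdy (A t) p
        + Complex.I * (β : ℂ) * A t p * ((pdy (φ t) p : ℝ) : ℂ)
  eq_φ : ∀ t ∈ Icc (0 : ℝ) T, ∀ p ∈ Ω,
    deriv (fun s => φ s p) t =
      D₁ * pdx (pdx (φ t)) p + D₂ * pdy (pdy (φ t)) p - h * φ t p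
        + φ t p * ‖A t p‖ ^ 2 - c₂ * ((starRingEnd ℂ) (A t p) * pdy (A t) p).im

lemma chev_integrableOn {Ω : Set (ℝ × ℝ)} (hb : Bornology.IsBounded Ω) {f : ℝ × ℝ → ℝ}
    (hf : Continuous f) : IntegrableOn f Ω :=
  (hf.continuousOn.integrableOn_compact hb.isCompact_closure).mono_set subset_closure

lemma chev_hasDerivAt {E : Type*} [NormedAddCommGroup E] [InnerProductSpace ℝ E]
    {Ω : Set (ℝ × ℝ)} (ho : IsOpen Ω) (hb : Bornology.IsBounded Ω) {u : ℝ → ℝ × ℝ → E}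
    (hu : ContDiff ℝ 1 (fun q : ℝ × (ℝ × ℝ) => u q.1 q.2)) (t : ℝ) :
    Continuous (fun p => deriv (fun s => u s p) t) ∧
    HasDerivAt (fun s => ∫ p in Ω, ‖u s p‖ ^ 2)
      (∫ p in Ω, 2 * inner ℝ (u t p) (deriv (fun s => u s p) t)) t := by
  set U : ℝ × (ℝ × ℝ) → E := fun q => u q.1 q.2 with hU
  have hder : ∀ s p, HasDerivAt (fun s => u s p) (fderiv ℝ U (s, p) (1, 0)) s := by
    intro s p
    have h1 : HasFDerivAt U (fderiv ℝ U (s, p)) (s, p) :=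
      ((hu.differentiable one_ne_zero) (s, p)).hasFDerivAt
    have h2 : HasDerivAt (fun s : ℝ => (s, p)) ((1 : ℝ), (0 : ℝ × ℝ)) s :=
      (hasDerivAt_id s).prodMk (hasDerivAt_const s p)
    exact h1.comp_hasDerivAt s h2
  have hcU : Continuous U := hu.continuous
  have hcD : Continuous (fun q => fderiv ℝ U q (1, 0)) :=
    (hu.continuous_fderiv one_ne_zero).clm_apply continuous_const
  have hde : ∀ s p, deriv (fun s => u s p) s = fderiv ℝ U (s, p) (1, 0) :=
    fun s p => (hder s p).deriv
  simp only [hde]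
  refine ⟨by fun_prop, ?_⟩
  have hcG : Continuous (fun q => 2 * inner ℝ (U q) (fderiv ℝ U q (1, 0))) :=
    continuous_const.mul (hcU.inner hcD)
  obtain ⟨C, hC⟩ := ((isCompact_closedBall t 1).prod hb.isCompact_closure).exists_bound_of_continuousOn
    hcG.continuousOn
  have hfin : volume Ω ≠ ⊤ := hb.measure_lt_top.ne
  have hus : ∀ s, Continuous (u s) := fun s =>
    hcU.comp (Continuous.prodMk continuous_const continuous_id)
  refine (hasDerivAt_integral_of_dominated_loc_of_deriv_le (μ := volume.restrict Ω)
    (F := fun s p => ‖u s p‖ ^ 2)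
    (F' := fun s p => 2 * inner ℝ (U (s, p)) (fderiv ℝ U (s, p) (1, 0)))
    (s := Metric.closedBall t 1) (bound := fun _ => C)
    (Metric.closedBall_mem_nhds t one_pos) ?_ ?_ ?_ ?_ ?_ ?_).2
  · exact Filter.Eventually.of_forall fun s => ((hus s).norm.pow 2).aestronglyMeasurable
  · exact chev_integrableOn hb ((hus t).norm.pow 2)
  · exact (hcG.comp (Continuous.prodMk continuous_const continuous_id)).aestronglyMeasurable
  · refine (ae_restrict_iff' ho.measurableSet).2 (Filter.Eventually.of_forall ?_)
    intro p hp s hs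
    exact hC (s, p) ⟨hs, subset_closure hp⟩
  · exact integrableOn_const hfin
  · refine Filter.Eventually.of_forall ?_
    intro p s _
    exact (hder s p).norm_sq

lemma chev_ibp {E : Type*} [NormedAddCommGroup E] [InnerProductSpace ℝ E]
    {Ω K : Set (ℝ × ℝ)} (hK : IsCompact K) (hKΩ : K ⊆ Ω) {f : ℝ × ℝ → E}
    (hf : ContDiff ℝ 2 f) (hs : Function.support f ⊆ K) (v : ℝ × ℝ) :
    Continuous (fun p => fderiv ℝ f p v) ∧
    Continuous (fun p => fderiv ℝ (fun q => fderiv ℝ f q v) p v) ∧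
    ∫ p in Ω, (inner ℝ (f p) (fderiv ℝ (fun q => fderiv ℝ f q v) p v)
      + ‖fderiv ℝ f p v‖ ^ 2) = 0 := by
  have hg : ContDiff ℝ 1 (fun q => fderiv ℝ f q v) :=
    (hf.fderiv_right (m := 1) (by norm_num)).clm_apply contDiff_const
  have hgd : Continuous (fun p => fderiv ℝ (fun q => fderiv ℝ f q v) p v) :=
    (hg.continuous_fderiv one_ne_zero).clm_apply continuous_const
  have hts : tsupport f ⊆ K := closure_minimal hs hK.isClosed
  have hcs : HasCompactSupport f := hK.of_isClosed_subset (isClosed_tsupport f) hts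
  have hf0 : ∀ p, p ∉ K → f p = 0 := fun p hp => by
    by_contra h
    exact hp (hs h)
  have hd0 : ∀ p, p ∉ K → fderiv ℝ f p = 0 := fun p hp =>
    fderiv_of_notMem_tsupport ℝ (fun h => hp (hts h))
  refine ⟨hg.continuous, hgd, ?_⟩
  have i1 : Integrable (fun p => inner ℝ (f p) (fderiv ℝ (fun q => fderiv ℝ f q v) p v)) :=
    (hf.continuous.inner hgd).integrable_of_hasCompactSupport
      (HasCompactSupport.intro hK fun p hp => by simp [hf0 p hp])
  have i2 : Integrable (fun p => inner ℝ (fderiv ℝ f p v) (fderiv ℝ f p v)) :=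
    (hg.continuous.inner hg.continuous).integrable_of_hasCompactSupport
      (HasCompactSupport.intro hK fun p hp => by simp [hd0 p hp])
  have i3 : Integrable (fun p => inner ℝ (f p) (fderiv ℝ f p v)) :=
    (hf.continuous.inner hg.continuous).integrable_of_hasCompactSupport
      (HasCompactSupport.intro hK fun p hp => by simp [hf0 p hp])
  have key : ∫ p, inner ℝ (f p) (fderiv ℝ (fun q => fderiv ℝ f q v) p v)
      = - ∫ p, inner ℝ (fderiv ℝ f p v) (fderiv ℝ f p v) := integral_bilinear_fderiv_right_eq_neg_left_of_integrable (μ := volume)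
    (f := f) (g := fun q => fderiv ℝ f q v) (v := v) (B := innerSL ℝ)
    i2 i1 i3
    (fun x _ => (hf.differentiable two_ne_zero) x) (fun x _ => (hg.differentiable one_ne_zero) x)
  rw [setIntegral_eq_integral_of_forall_compl_eq_zero]
  · simp only [← real_inner_self_eq_norm_sq]
    rw [integral_add i1 i2, key]
    ring
  · intro p hp
    have : p ∉ K := fun h => hp (hKΩ h)
    simp [hf0 p this, hd0 p this]

lemma chev_alg (δ c₁ c₂ φ a b x y u w : ℝ) (hδ : 0 ≤ δ) (hc₂ : 0 < c₂) (hc₁ : 0 ≤ c₁)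
    (he : 2 * (1 - δ) = 2 * c₁ + δ * c₂) :
    2 * (a ^ 2 + b ^ 2) - (a ^ 2 + b ^ 2) ^ 2 - (1 - δ) * (x ^ 2 + y ^ 2 + u ^ 2 + w ^ 2)
      - (1 - δ) * φ ^ 2 * (a ^ 2 + b ^ 2) + (2 * c₁ - δ * c₂) * φ * (a * w - b * u) ≤ 1 := by
  have h1 : 0 ≤ δ * c₂ := by positivity
  have e : 1 - δ = c₁ + δ * c₂ / 2 := by linarith
  rw [e]
  generalize δ * c₂ = m at *
  have k1 : 0 ≤ (m / 2) * (x ^ 2 + y ^ 2 + (u - φ * b) ^ 2 + (w + φ * a) ^ 2) := by positivity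
  have k2 : 0 ≤ c₁ * (x ^ 2 + y ^ 2 + (u + φ * b) ^ 2 + (w - φ * a) ^ 2) := by positivity
  nlinarith [sq_nonneg (a ^ 2 + b ^ 2 - 1)]

lemma chev_pointwise (δ τ h D₁ D₂ c₁ c₂ β φ φt φx φy φxx φyy : ℝ) (a adt ax ay axx ayy : ℂ)
    (hδ : 0 ≤ δ) (hc₂ : 0 < c₂) (hc₁ : 0 ≤ c₁)
    (he : 2 * (1 - δ) = 2 * c₁ + δ * c₂)
    (hA : (τ : ℂ) * adt = a + (axx + ayy) - (φ : ℂ) ^ 2 * a - (‖a‖ ^ 2 : ℝ) * a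
        - 2 * Complex.I * (c₁ : ℂ) * (φ : ℂ) * ay + Complex.I * (β : ℂ) * a * (φy : ℂ))
    (hφ : φt = D₁ * φxx + D₂ * φyy - h * φ + φ * ‖a‖ ^ 2
      - c₂ * ((starRingEnd ℂ) a * ay).im) :
    τ * inner ℝ a adt + δ * inner ℝ φ φt + ‖a‖ ^ 2 + δ * h * ‖φ‖ ^ 2
      + δ * (‖ax‖ ^ 2 + ‖ay‖ ^ 2) + δ * min D₁ D₂ * (‖φx‖ ^ 2 + ‖φy‖ ^ 2)
      ≤ 1 + (inner ℝ a axx + ‖ax‖ ^ 2) + (inner ℝ a ayy + ‖ay‖ ^ 2)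
        + δ * D₁ * (inner ℝ φ φxx + ‖φx‖ ^ 2) + δ * D₂ * (inner ℝ φ φyy + ‖φy‖ ^ 2) := by
  have hn : ∀ z : ℂ, ‖z‖ ^ 2 = z.re ^ 2 + z.im ^ 2 := fun z => by
    rw [Complex.sq_norm, Complex.normSq_apply]; ring
  have hre := congrArg Complex.re hA
  have him := congrArg Complex.im hA
  rw [hn] at hre him hφ
  simp [← Complex.ofReal_pow] at hre him
  have e1 : τ * inner ℝ a adt = a.re * (τ * adt.re) + a.im * (τ * adt.im) := by
    simp [Complex.inner]; ring
  have e2 : ∀ r s : ℝ, inner ℝ r s = r * s := fun r s => by simp [mul_comm]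
  rw [e1, hre, him, e2, e2, e2, hφ]
  simp only [hn, Complex.inner, Real.norm_eq_abs, sq_abs]
  simp
  have k := chev_alg δ c₁ c₂ φ a.re a.im ax.re ax.im ay.re ay.im hδ hc₂ hc₁ he
  have m1 : 0 ≤ δ * (D₁ - min D₁ D₂) * φx ^ 2 :=
    mul_nonneg (mul_nonneg hδ (sub_nonneg.2 (min_le_left _ _))) (sq_nonneg _)
  have m2 : 0 ≤ δ * (D₂ - min D₁ D₂) * φy ^ 2 :=
    mul_nonneg (mul_nonneg hδ (sub_nonneg.2 (min_le_right _ _))) (sq_nonneg _)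
  generalize min D₁ D₂ = D₀ at *
  nlinarith [k, m1, m2]

/-- differential a priori inequality
`(1/2)·d/dt[τ‖A‖² + δ₀‖φ‖²] + ‖A‖² + δ₀h‖φ‖² + δ₀‖∇A‖² + δ₀D₀‖∇φ‖² ≤ |Ω|`
with `δ₀ = 2(1−c₁)/(2+c₂)` and `D₀ = min(D₁,D₂)`. -/
theorem chevron_differential_inequality
    (Ω : Set (ℝ × ℝ)) (hΩ_open : IsOpen Ω) (hΩ_ne : Ω.Nonempty)
    (hΩ_bdd : Bornology.IsBounded Ω)
    (T τ D₁ D₂ h c₁ c₂ β : ℝ) (hT : 0 ≤ T) (hτ : 0 < τ)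
    (hD₁ : 0 < D₁) (hD₂ : 0 < D₂) (hh : 0 < h) (hc₂ : 0 < c₂)
    (hc₁0 : 0 ≤ c₁) (hc₁1 : c₁ < 1)
    (A : ℝ → ℝ × ℝ → ℂ) (φ : ℝ → ℝ × ℝ → ℝ)
    (hsol : IsChevronSolution Ω T τ D₁ D₂ h c₁ c₂ β A φ) :
    ∀ t ∈ Icc (0 : ℝ) T, ∃ d : ℝ,
      HasDerivAt (fun s => τ * l2sq Ω (A s) + (2 * (1 - c₁) / (2 + c₂)) * l2sq Ω (φ s)) d t ∧
      (1 / 2) * d + l2sq Ω (A t) + (2 * (1 - c₁) / (2 + c₂)) * h * l2sq Ω (φ t)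
          + (2 * (1 - c₁) / (2 + c₂)) * gradl2sq Ω (A t)
          + (2 * (1 - c₁) / (2 + c₂)) * min D₁ D₂ * gradl2sq Ω (φ t)
        ≤ (volume Ω).toReal := by
  intro t ht
  obtain ⟨K, hK, hKΩ, hsupp⟩ := hsol.support
  obtain ⟨cAt, dA⟩ := chev_hasDerivAt hΩ_open hΩ_bdd hsol.smooth_A t
  obtain ⟨cφt, dφ⟩ := chev_hasDerivAt hΩ_open hΩ_bdd hsol.smooth_φ t
  obtain ⟨cAx, cAxx, iAx⟩ := chev_ibp hK hKΩ (hsol.space_A t ht) (hsupp t).1 (1, 0)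
  obtain ⟨cAy, cAyy, iAy⟩ := chev_ibp hK hKΩ (hsol.space_A t ht) (hsupp t).1 (0, 1)
  obtain ⟨cφx, cφxx, iφx⟩ := chev_ibp hK hKΩ (hsol.space_φ t ht) (hsupp t).2 (1, 0)
  obtain ⟨cφy, cφyy, iφy⟩ := chev_ibp hK hKΩ (hsol.space_φ t ht) (hsupp t).2 (0, 1)
  have cA : Continuous (A t) := (hsol.space_A t ht).continuous
  have cφ : Continuous (φ t) := (hsol.space_φ t ht).continuous
  have hδ : 0 ≤ 2 * (1 - c₁) / (2 + c₂) :=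
    div_nonneg (by linarith) (by linarith)
  have he : 2 * (1 - 2 * (1 - c₁) / (2 + c₂)) = 2 * c₁ + 2 * (1 - c₁) / (2 + c₂) * c₂ := by
    field_simp
    ring
  generalize 2 * (1 - c₁) / (2 + c₂) = δ at *
  refine ⟨_, (dA.const_mul τ).add (dφ.const_mul δ), ?_⟩
  have hpt : ∀ p ∈ Ω, _ := fun p hp => chev_pointwise δ τ h D₁ D₂ c₁ c₂ β (φ t p)
    (deriv (fun s => φ s p) t) (fderiv ℝ (φ t) p (1, 0)) (fderiv ℝ (φ t) p (0, 1))
    (fderiv ℝ (fun q => fderiv ℝ (φ t) q (1, 0)) p (1, 0))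
    (fderiv ℝ (fun q => fderiv ℝ (φ t) q (0, 1)) p (0, 1))
    (A t p) (deriv (fun s => A s p) t)
    (fderiv ℝ (A t) p (1, 0)) (fderiv ℝ (A t) p (0, 1))
    (fderiv ℝ (fun q => fderiv ℝ (A t) q (1, 0)) p (1, 0))
    (fderiv ℝ (fun q => fderiv ℝ (A t) q (0, 1)) p (0, 1))
    hδ hc₂ hc₁0 he (hsol.eq_A t ht p hp) (hsol.eq_φ t ht p hp)
  have J : ∀ {f : ℝ × ℝ → ℝ}, Continuous f → Integrable f (volume.restrict Ω) :=
    fun hf => chev_integrableOn hΩ_bdd hf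
  have mono := setIntegral_mono_on (chev_integrableOn hΩ_bdd (by fun_prop))
    (chev_integrableOn hΩ_bdd (by fun_prop)) hΩ_open.measurableSet hpt
  rw [integral_add (J (by fun_prop)) (J (by fun_prop)),
    integral_add (J (by fun_prop)) (J (by fun_prop)),
    integral_add (J (by fun_prop)) (J (by fun_prop)),
    integral_add (J (by fun_prop)) (J (by fun_prop)),
    integral_add (J (by fun_prop)) (J (by fun_prop)),
    integral_add (J (by fun_prop)) (J (by fun_prop)),
    integral_add (J (by fun_prop)) (J (by fun_prop)),
    integral_add (J (by fun_prop)) (J (by fun_prop)),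
    integral_add (J (by fun_prop)) (J (by fun_prop))] at mono
  simp only [integral_const_mul] at mono
  rw [iAx, iAy, iφx, iφy] at mono
  simp only [integral_const_mul, l2sq, gradl2sq, pdx, pdy]
  simp only [integral_const, smul_eq_mul, mul_one, Measure.real, Measure.restrict_apply_univ] at mono
  linarith
end
end

section
/- For all continuously differentiable, compactly supported functions u, v : ℝ² → ℂ: ∫_{ℝ²} |u|²|v|² ≤ 2·‖u‖_{L²}·‖∇u‖_{L²}·‖v‖_{L²}·‖∇v‖_{L²}. -/
open MeasureTheory

noncomputable section

lemma bl_oned (g : ℝ → ℂ) (hg : ContDiff ℝ 1 g) (hs : HasCompactSupport g) (x : ℝ) :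
    ‖g x‖ ^ 2 ≤ ∫ t, ‖g t‖ * ‖deriv g t‖ := by
  set f : ℝ → ℝ := fun t => ‖g t‖ ^ 2 with hf
  have hfc : ContDiff ℝ 1 f := hg.norm_sq ℝ
  have hfs : HasCompactSupport f := by
    apply hs.comp_left (g := fun z : ℂ => ‖z‖ ^ 2)
    simp
  have h1 := hfs.integral_Iic_deriv_eq hfc x
  have h2 := hfs.integral_Ioi_deriv_eq hfc x
  have hdc : Continuous (deriv f) := hfc.continuous_deriv le_rfl
  have hdi : Integrable (deriv f) := hdc.integrable_of_hasCompactSupport hfs.deriv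
  have hgd : Continuous (deriv g) := hg.continuous_deriv le_rfl
  have hgi : Integrable (fun t => ‖g t‖ * ‖deriv g t‖) := by
    apply Continuous.integrable_of_hasCompactSupport
    · exact hg.continuous.norm.mul hgd.norm
    · exact hs.norm.mul_right
  have hb : ∀ t, |deriv f t| ≤ 2 * (‖g t‖ * ‖deriv g t‖) := by
    intro t
    have hd : HasDerivAt g (deriv g t) t :=
      ((hg.differentiable one_ne_zero) t).hasDerivAt
    have := hd.norm_sq
    rw [this.deriv, abs_mul, abs_two]
    gcongr
    exact abs_real_inner_le_norm _ _
  have h3 : ∫ t, |deriv f t| ≤ ∫ t, 2 * (‖g t‖ * ‖deriv g t‖) :=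
    integral_mono hdi.abs (hgi.const_mul 2) hb
  rw [integral_const_mul] at h3
  have h4 := intervalIntegral.integral_Iic_add_Ioi (b := x) hdi.abs.integrableOn hdi.abs.integrableOn
  have h5 : |∫ t in Set.Iic x, deriv f t| ≤ ∫ t in Set.Iic x, |deriv f t| := abs_integral_le_integral_abs
  have h6 : |∫ t in Set.Ioi x, deriv f t| ≤ ∫ t in Set.Ioi x, |deriv f t| := abs_integral_le_integral_abs
  rw [h1] at h5
  rw [h2, abs_neg] at h6
  have h7 := le_abs_self (f x)
  change f x ≤ _
  linarith

lemma bl_cs (a b : ℝ × ℝ → ℂ) (ha : Continuous a) (hb : Continuous b)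
    (hsa : HasCompactSupport a) (hsb : HasCompactSupport b) :
    ∫ p, ‖a p‖ * ‖b p‖ ≤ Real.sqrt (∫ p, ‖a p‖ ^ 2) * Real.sqrt (∫ p, ‖b p‖ ^ 2) := by
  have := integral_mul_norm_le_Lp_mul_Lq (μ := (volume : Measure (ℝ × ℝ))) (f := a) (g := b)
    (p := 2) (q := 2) Real.HolderConjugate.two_two
    (ha.memLp_of_hasCompactSupport hsa) (hb.memLp_of_hasCompactSupport hsb)
  simpa [Real.sqrt_eq_rpow] using this

lemma bl_pdx_le (u : ℝ × ℝ → ℂ) (hu : ContDiff ℝ 1 u) (hsu : HasCompactSupport u) (x y : ℝ) :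
    ‖u (x, y)‖ ^ 2 ≤ ∫ t, ‖u (t, y)‖ * ‖pdx u (t, y)‖ := by
  have h := bl_oned (fun t => u (t, y)) (hu.comp (by fun_prop))
    (hsu.comp_isClosedEmbedding (Topology.IsClosedEmbedding.of_continuous_injective_isClosedMap
      (by fun_prop) (fun a b h => by simpa using h) (isClosedMap_prodMk_right y))) x
  have hd : ∀ t, deriv (fun t => u (t, y)) t = pdx u (t, y) := by
    intro t
    have h1 : HasFDerivAt u (fderiv ℝ u (t, y)) (t, y) :=
      (hu.differentiable one_ne_zero (t, y)).hasFDerivAt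
    have h2 : HasDerivAt (fun t : ℝ => (t, y)) ((1 : ℝ), (0 : ℝ)) t :=
      (hasDerivAt_id t).prodMk (hasDerivAt_const t y)
    exact (h1.comp_hasDerivAt t h2).deriv
  simpa only [hd] using h

lemma bl_pdy_le (u : ℝ × ℝ → ℂ) (hu : ContDiff ℝ 1 u) (hsu : HasCompactSupport u) (x y : ℝ) :
    ‖u (x, y)‖ ^ 2 ≤ ∫ t, ‖u (x, t)‖ * ‖pdy u (x, t)‖ := by
  have h := bl_oned (fun t => u (x, t)) (hu.comp (by fun_prop))
    (hsu.comp_isClosedEmbedding (Topology.IsClosedEmbedding.of_continuous_injective_isClosedMap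
      (by fun_prop) (fun a b h => by simpa using h) (isClosedMap_prodMk_left x))) y
  have hd : ∀ t, deriv (fun t => u (x, t)) t = pdy u (x, t) := by
    intro t
    have h1 : HasFDerivAt u (fderiv ℝ u (x, t)) (x, t) :=
      (hu.differentiable one_ne_zero (x, t)).hasFDerivAt
    have h2 : HasDerivAt (fun t : ℝ => (x, t)) ((0 : ℝ), (1 : ℝ)) t :=
      (hasDerivAt_const t x).prodMk (hasDerivAt_id t)
    exact (h1.comp_hasDerivAt t h2).deriv
  simpa only [hd] using h

/-- the bilinear Ladyzhenskaya-type estimate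
`∫ |u|²|v|² ≤ 2‖u‖_{L²}‖∇u‖_{L²}‖v‖_{L²}‖∇v‖_{L²}` for `u, v ∈ C¹_c(ℝ², ℂ)`. -/
theorem bilinear_ladyzhenskaya
    (u v : ℝ × ℝ → ℂ) (hu : ContDiff ℝ 1 u) (hv : ContDiff ℝ 1 v)
    (hsu : HasCompactSupport u) (hsv : HasCompactSupport v) :
    (∫ p : ℝ × ℝ, ‖u p‖ ^ 2 * ‖v p‖ ^ 2) ≤
      2 * Real.sqrt (∫ p : ℝ × ℝ, ‖u p‖ ^ 2)
        * Real.sqrt (∫ p : ℝ × ℝ, (‖pdx u p‖ ^ 2 + ‖pdy u p‖ ^ 2))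
        * Real.sqrt (∫ p : ℝ × ℝ, ‖v p‖ ^ 2)
        * Real.sqrt (∫ p : ℝ × ℝ, (‖pdx v p‖ ^ 2 + ‖pdy v p‖ ^ 2)) := by
  have hcd : ∀ (w : ℝ × ℝ → ℂ), ContDiff ℝ 1 w → ∀ e, Continuous (fun p => fderiv ℝ w p e) :=
    fun w hw e => (hw.continuous_fderiv one_ne_zero).clm_apply continuous_const
  have hsd : ∀ (w : ℝ × ℝ → ℂ), HasCompactSupport w → ∀ e,
      HasCompactSupport (fun p => fderiv ℝ w p e) := fun w hw e => hw.fderiv_apply ℝ e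
  have cux : Continuous (pdx u) := hcd u hu _
  have cuy : Continuous (pdy u) := hcd u hu _
  have cvx : Continuous (pdx v) := hcd v hv _
  have cvy : Continuous (pdy v) := hcd v hv _
  have sux : HasCompactSupport (pdx u) := hsd u hsu _
  have suy : HasCompactSupport (pdy u) := hsd u hsu _
  have svx : HasCompactSupport (pdx v) := hsd v hsv _
  have svy : HasCompactSupport (pdy v) := hsd v hsv _
  have isq : ∀ (w : ℝ × ℝ → ℂ), Continuous w → HasCompactSupport w →
      Integrable (fun p => ‖w p‖ ^ 2) := fun w hw hs =>
    Continuous.integrable_of_hasCompactSupport (by fun_prop)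
      (hs.comp_left (g := fun z : ℂ => ‖z‖ ^ 2) (by simp))
  have iu : Integrable (fun p => ‖u p‖ * ‖pdx u p‖) :=
    (hu.continuous.norm.mul cux.norm).integrable_of_hasCompactSupport hsu.norm.mul_right
  have iv : Integrable (fun p => ‖v p‖ * ‖pdy v p‖) :=
    (hv.continuous.norm.mul cvy.norm).integrable_of_hasCompactSupport hsv.norm.mul_right
  have iuv : Integrable (fun p => ‖u p‖ ^ 2 * ‖v p‖ ^ 2) :=
    Continuous.integrable_of_hasCompactSupport
      ((hu.continuous.norm.pow 2).mul (hv.continuous.norm.pow 2))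
      (HasCompactSupport.mul_right (hsu.comp_left (g := fun z : ℂ => ‖z‖ ^ 2) (by simp)))
  set A : ℝ → ℝ := fun y => ∫ t, ‖u (t, y)‖ * ‖pdx u (t, y)‖ with hA
  set B : ℝ → ℝ := fun x => ∫ t, ‖v (x, t)‖ * ‖pdy v (x, t)‖ with hB
  have iA : Integrable A := iu.integral_prod_right
  have iB : Integrable B := iv.integral_prod_left
  have eA : ∫ y, A y = ∫ p, ‖u p‖ * ‖pdx u p‖ := (integral_prod_symm _ iu).symm
  have eB : ∫ x, B x = ∫ p, ‖v p‖ * ‖pdy v p‖ := (integral_prod _ iv).symm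
  have main : (∫ p : ℝ × ℝ, ‖u p‖ ^ 2 * ‖v p‖ ^ 2) ≤ (∫ x, B x) * ∫ y, A y := by
    rw [← integral_prod_mul]
    refine integral_mono iuv (iB.mul_prod iA) ?_
    rintro ⟨x, y⟩
    have h1 := bl_pdx_le u hu hsu x y
    have h2 := bl_pdy_le v hv hsv x y
    have h3 : ‖u (x, y)‖ ^ 2 * ‖v (x, y)‖ ^ 2 ≤ A y * B x :=
      mul_le_mul h1 h2 (by positivity) ((by positivity : (0 : ℝ) ≤ ‖u (x, y)‖ ^ 2).trans h1)
    simpa only [mul_comm] using h3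
  have cA := bl_cs u (pdx u) hu.continuous cux hsu sux
  have cB := bl_cs v (pdy v) hv.continuous cvy hsv svy
  have gA : Real.sqrt (∫ p, ‖pdx u p‖ ^ 2) ≤
      Real.sqrt (∫ p : ℝ × ℝ, (‖pdx u p‖ ^ 2 + ‖pdy u p‖ ^ 2)) :=
    Real.sqrt_le_sqrt (integral_mono (isq _ cux sux) ((isq _ cux sux).add (isq _ cuy suy))
      (fun p => le_add_of_nonneg_right (by positivity)))
  have gB : Real.sqrt (∫ p, ‖pdy v p‖ ^ 2) ≤
      Real.sqrt (∫ p : ℝ × ℝ, (‖pdx v p‖ ^ 2 + ‖pdy v p‖ ^ 2)) :=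
    Real.sqrt_le_sqrt (integral_mono (isq _ cvy svy) ((isq _ cvx svx).add (isq _ cvy svy))
      (fun p => le_add_of_nonneg_left (by positivity)))
  rw [eA, eB] at main
  have nA : 0 ≤ ∫ p, ‖u p‖ * ‖pdx u p‖ := integral_nonneg (fun p => by positivity)
  have cAA := cA.trans (mul_le_mul_of_nonneg_left gA (Real.sqrt_nonneg _))
  have cBB := cB.trans (mul_le_mul_of_nonneg_left gB (Real.sqrt_nonneg _))
  have fin := main.trans (mul_le_mul cBB cAA nA (by positivity))
  refine fin.trans ?_
  generalize Real.sqrt (∫ p : ℝ × ℝ, (‖pdx u p‖ ^ 2 + ‖pdy u p‖ ^ 2)) = d at gA ⊢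
  have hd : 0 ≤ d := (Real.sqrt_nonneg _).trans gA
  generalize Real.sqrt (∫ p : ℝ × ℝ, (‖pdx v p‖ ^ 2 + ‖pdy v p‖ ^ 2)) = e at gB ⊢
  have he : 0 ≤ e := (Real.sqrt_nonneg _).trans gB
  have ha := Real.sqrt_nonneg (∫ p : ℝ × ℝ, ‖u p‖ ^ 2)
  have hb := Real.sqrt_nonneg (∫ p : ℝ × ℝ, ‖v p‖ ^ 2)
  have hm := mul_nonneg (mul_nonneg ha hd) (mul_nonneg hb he)
  linarith
end
end

section
/- Let τ > 0, h > 0, c₂ ∈ ℝ, 0 ≤ c₁ < 1, and let χ ∈ ℝ satisfy (1−c₁²)χ² > 1. Then the only equilibrium of the reduced chevron vector field G is the origin (0,0). -/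
/-- for `0 ≤ c₁ < 1` and a phase gradient `χ` with
`(1−c₁²)χ² > 1`, the only equilibrium of the reduced chevron vector field
`G(ρ,φ) = (ρ[(1−ρ²) − (φ−c₁χ)² − (1−c₁²)χ²]/τ, −hφ + ρ²(φ−c₂χ))` is the origin. -/
theorem reduced_chevron_only_trivial_equilibrium
    (τ h c₁ c₂ χ : ℝ) (hτ : 0 < τ) (hh : 0 < h)
    (hc₁0 : 0 ≤ c₁) (hc₁1 : c₁ < 1) (hχ : 1 < (1 - c₁ ^ 2) * χ ^ 2) :
    {p : ℝ × ℝ |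
        (p.1 * ((1 - p.1 ^ 2) - (p.2 - c₁ * χ) ^ 2 - (1 - c₁ ^ 2) * χ ^ 2) / τ,
          -h * p.2 + p.1 ^ 2 * (p.2 - c₂ * χ)) = (0, 0)} =
      {((0 : ℝ), (0 : ℝ))} := by
  ext ⟨r, f⟩
  simp only [Set.mem_setOf_eq, Set.mem_singleton_iff, Prod.mk.injEq]
  constructor
  · rintro ⟨h1, h2⟩
    have hr : r = 0 := by
      rcases div_eq_zero_iff.mp h1 with h3 | h3
      · rcases mul_eq_zero.mp h3 with h4 | h4
        · exact h4
        · exfalso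
          have := sq_nonneg r
          have := sq_nonneg (f - c₁ * χ)
          linarith
      · exact absurd h3 hτ.ne'
    subst hr
    refine ⟨rfl, ?_⟩
    have h5 : h * f = 0 := by linarith
    exact (mul_eq_zero.mp h5).resolve_left hh.ne'
  · rintro ⟨rfl, rfl⟩
    simp
end

section
/- Let τ > 0, h > 0, c₁, c₂ ∈ ℝ, and let χ ∈ ℝ satisfy χ² < 1. Then the reduced chevron vector field G has an equilibrium (ρ,φ) with ρ > 0; i.e., for small phase gradients a nontrivial (pattern-forming) equilibrium exists. -/
/-- for any phase gradient `χ` with `χ² < 1`, the reduced chevron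
vector field `G(ρ,φ) = (ρ[(1−ρ²) − (φ−c₁χ)² − (1−c₁²)χ²]/τ, −hφ + ρ²(φ−c₂χ))`
has a nontrivial equilibrium with `ρ > 0`. -/
theorem reduced_chevron_nontrivial_equilibrium_exists
    (τ h c₁ c₂ χ : ℝ) (hτ : 0 < τ) (hh : 0 < h) (hχ : χ ^ 2 < 1) :
    ∃ ρ φ : ℝ, 0 < ρ ∧
      (ρ * ((1 - ρ ^ 2) - (φ - c₁ * χ) ^ 2 - (1 - c₁ ^ 2) * χ ^ 2) / τ,
        -h * φ + ρ ^ 2 * (φ - c₂ * χ)) = ((0 : ℝ), (0 : ℝ)) := by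
  have hE : 0 ≤ (c₁ * χ) ^ 2 + (1 - χ ^ 2) := by nlinarith [sq_nonneg (c₁ * χ)]
  obtain ⟨D, hD0, hD⟩ : ∃ D : ℝ, 0 ≤ D ∧ D ^ 2 = (c₁ * χ) ^ 2 + (1 - χ ^ 2) :=
    ⟨_, Real.sqrt_nonneg _, Real.sq_sqrt hE⟩
  obtain ⟨h1, h2⟩ := abs_lt.mp (abs_lt_of_sq_lt_sq (by linarith : (c₁ * χ) ^ 2 < D ^ 2) hD0)
  have key : (0 : ℝ) ∈ (fun φ : ℝ => -h * φ + (D ^ 2 - (φ - c₁ * χ) ^ 2) * (φ - c₂ * χ)) ''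
      Set.Ioo (c₁ * χ - D) (c₁ * χ + D) := by
    apply intermediate_value_Ioo' (by linarith)
    · fun_prop
    · constructor
      · have : 0 < h * (c₁ * χ + D) := mul_pos hh (by linarith)
        ring_nf at this ⊢
        linarith
      · have : 0 < h * (D - c₁ * χ) := mul_pos hh (by linarith)
        ring_nf at this ⊢
        linarith
  obtain ⟨φ, ⟨ha, hb⟩, hφ⟩ := key
  have hR : 0 < D ^ 2 - (φ - c₁ * χ) ^ 2 := by nlinarith
  refine ⟨Real.sqrt (D ^ 2 - (φ - c₁ * χ) ^ 2), φ, Real.sqrt_pos.mpr hR, ?_⟩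
  rw [Real.sq_sqrt hR.le]
  refine Prod.ext ?_ hφ
  have : (1 - (D ^ 2 - (φ - c₁ * χ) ^ 2)) - (φ - c₁ * χ) ^ 2 - (1 - c₁ ^ 2) * χ ^ 2 = 0 := by
    rw [hD]; ring
  simp [this]
end
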